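/- arXiv:2112.03499 — 2 statements merged into one kernel-verified Lean document; each statement's English description precedes it below -/
import Mathlib

section
/- ℍ and ℍ' are ℝ-subspaces of Fin n → Polynomial ℝ with ℍ strictly contained in ℍ'; moreover dim ℍ = K + 1 and dim ℍ' = K + 2K' + 3, so that dim ℍ' / dim ℍ = (K + 2K' + 3) / (K + 1). -/
/-- `v k`: the constant tuple all of whose entries equal the monomial `X^k`. -/
noncomputable def vTuple (n K : ℕ) : Fin (K + 1) → (Fin n → Polynomial ℝ) :=
  fun k _ => Polynomial.X ^ (k : ℕ)

/-- `w j`: first `t` entries equal `X^j`, remaining entries are `0`. -/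
noncomputable def wTuple (n K' t : ℕ) : Fin (K' + 1) → (Fin n → Polynomial ℝ) :=
  fun j i => if (i : ℕ) < t then Polynomial.X ^ (j : ℕ) else 0

/-- `u j`: last `t` entries equal `X^j`, remaining entries are `0`. -/
noncomputable def uTuple (n K' t : ℕ) : Fin (K' + 1) → (Fin n → Polynomial ℝ) :=
  fun j i => if n - t ≤ (i : ℕ) then Polynomial.X ^ (j : ℕ) else 0

theorem linearIndependent_X_pow (R : Type*) [Semiring R] (m : ℕ) :
    LinearIndependent R (fun k : Fin m => (Polynomial.X : Polynomial R) ^ (k : ℕ)) := by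
  have h := (Polynomial.basisMonomials R).linearIndependent.comp
    (fun k : Fin m => (k : ℕ)) Fin.val_injective
  convert h using 2 with k
  simp [Polynomial.X_pow_eq_monomial]

theorem linearIndependent_vTuple_wTuple_uTuple (n K K' t : ℕ) (ht : 1 ≤ t) (htn : 2 * t < n) :
    LinearIndependent ℝ (Sum.elim (Sum.elim (vTuple n K) (wTuple n K' t)) (uTuple n K' t)) := by
  rw [Fintype.linearIndependent_iff]
  intro g hg
  have hsum (i : Fin n) := congrFun hg i
  simp only [Fintype.sum_sum_type, Sum.elim_inl, Sum.elim_inr, Finset.sum_apply,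
    Pi.smul_apply, Pi.zero_apply, vTuple, wTuple, uTuple] at hsum
  have hX {m : ℕ} := Fintype.linearIndependent_iff.1 (linearIndependent_X_pow ℝ m)
  have hv : ∀ k, g (.inl (.inl k)) = 0 := by
    have h := hsum ⟨t, by omega⟩
    simp only [lt_irrefl, if_false, if_neg (show ¬ n - t ≤ t by omega), smul_zero,
      Finset.sum_const_zero, add_zero] at h
    exact hX _ h
  have hw : ∀ j, g (.inl (.inr j)) = 0 := by
    have h := hsum ⟨0, by omega⟩
    simp only [hv, if_pos (show 0 < t by omega), if_neg (show ¬ n - t ≤ 0 by omega), smul_zero,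
      zero_smul, Finset.sum_const_zero, add_zero, zero_add] at h
    exact hX _ h
  have hu : ∀ j, g (.inr j) = 0 := by
    have h := hsum ⟨n - 1, by omega⟩
    simp only [hv, hw, if_pos (show n - t ≤ n - 1 by omega), zero_smul,
      Finset.sum_const_zero, zero_add] at h
    exact hX _ h
  rintro ((k | j) | j)
  exacts [hv k, hw j, hu j]

/-- `ℍ ⊂ ℍ'` strictly, `dim ℍ = K + 1`, `dim ℍ' = K + 2K' + 3`, and
hence `dim ℍ' / dim ℍ = (K + 2K' + 3)/(K + 1)`. -/
theorem filter_space_dimensions (n K K' t : ℕ) (hK' : K' ≤ K) (ht : 1 ≤ t)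
    (htn : 2 * t < n) :
    Submodule.span ℝ (Set.range (vTuple n K))
        < Submodule.span ℝ
            (Set.range (vTuple n K) ∪ Set.range (wTuple n K' t)
              ∪ Set.range (uTuple n K' t))
      ∧ Module.finrank ℝ ↥(Submodule.span ℝ (Set.range (vTuple n K))) = K + 1
      ∧ Module.finrank ℝ ↥(Submodule.span ℝ
            (Set.range (vTuple n K) ∪ Set.range (wTuple n K' t)
              ∪ Set.range (uTuple n K' t))) = K + 2 * K' + 3
      ∧ ((Module.finrank ℝ ↥(Submodule.span ℝ
            (Set.range (vTuple n K) ∪ Set.range (wTuple n K' t)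
              ∪ Set.range (uTuple n K' t))) : ℚ)
          / (Module.finrank ℝ ↥(Submodule.span ℝ (Set.range (vTuple n K))) : ℚ)
        = ((K : ℚ) + 2 * K' + 3) / ((K : ℚ) + 1)) := by
  have hli := linearIndependent_vTuple_wTuple_uTuple n K K' t ht htn
  have hv : Module.finrank ℝ ↥(Submodule.span ℝ (Set.range (vTuple n K))) = K + 1 := by
    have h := (hli.comp Sum.inl Sum.inl_injective).comp Sum.inl Sum.inl_injective
    simpa using finrank_span_eq_card (b := vTuple n K) h
  have hall : Module.finrank ℝ ↥(Submodule.span ℝ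
      (Set.range (vTuple n K) ∪ Set.range (wTuple n K' t)
        ∪ Set.range (uTuple n K' t))) = K + 2 * K' + 3 := by
    rw [← Set.Sum.elim_range, ← Set.Sum.elim_range, finrank_span_eq_card hli]
    simp only [Fintype.card_sum, Fintype.card_fin]
    omega
  refine ⟨lt_of_le_of_ne (Submodule.span_mono fun x hx => .inl (.inl hx)) fun h => ?_,
    hv, hall, ?_⟩
  · rw [← h, hv] at hall
    omega
  · rw [hv, hall]
    push_cast
    rfl
end

section
/- Let Ĥ be the ℝ-span of {w_0, …, w_{K'}} ∪ {u_0, …, u_{K'}} (the filters obtained from the adaptive filters alone, without any filter supported on the entire spectrum). Then ℍ ∩ Ĥ = {0}, ℍ + Ĥ = ℍ', and dim Ĥ = 2K' + 2; that is, ℍ' decomposes as the internal direct sum ℍ' = ℍ ⊕ Ĥ. -/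
theorem Submodule.span_apply_eq_zero {ι R M : Type*} [Semiring R] [AddCommMonoid M] [Module R M]
    {S : Set (ι → M)} {i : ι} (hS : ∀ g ∈ S, g i = 0) {f : ι → M}
    (hf : f ∈ Submodule.span R S) : f i = 0 := by
  have h : Submodule.span R S ≤ LinearMap.ker (LinearMap.proj (R := R) (φ := fun _ : ι => M) i) :=
    Submodule.span_le.2 hS
  exact h hf

theorem Submodule.span_apply_eq_apply {ι R M : Type*} [Semiring R] [AddCommMonoid M] [Module R M]
    {S : Set (ι → M)} {i j : ι} (hS : ∀ g ∈ S, g i = g j) {f : ι → M}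
    (hf : f ∈ Submodule.span R S) : f i = f j := by
  have h : Submodule.span R S ≤ LinearMap.eqLocus
      (LinearMap.proj (R := R) (φ := fun _ : ι => M) i)
      (LinearMap.proj (R := R) (φ := fun _ : ι => M) j) :=
    Submodule.span_le.2 hS
  exact h hf

theorem Polynomial.linearIndependent_X_pow_fin (R : Type*) [Semiring R] (m : ℕ) :
    LinearIndependent R (fun j : Fin m => (Polynomial.X ^ (j : ℕ) : Polynomial R)) := by
  have h := (Polynomial.basisMonomials R).linearIndependent.comp
    (fun j : Fin m => (j : ℕ)) Fin.val_injective
  convert h using 2 with j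
  simp [Polynomial.X_pow_eq_monomial]

theorem linearIndependent_wTuple {n t : ℕ} (K' : ℕ) (ht : 1 ≤ t) (hn : 0 < n) :
    LinearIndependent ℝ (wTuple n K' t) := by
  apply LinearIndependent.of_comp
    (LinearMap.proj (R := ℝ) (φ := fun _ : Fin n => Polynomial ℝ) ⟨0, hn⟩)
  convert Polynomial.linearIndependent_X_pow_fin ℝ (K' + 1) using 2 with j
  simp [wTuple, Nat.lt_of_succ_le ht]

theorem linearIndependent_uTuple {n t : ℕ} (K' : ℕ) (ht : 1 ≤ t) (hn : 0 < n) :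
    LinearIndependent ℝ (uTuple n K' t) := by
  apply LinearIndependent.of_comp
    (LinearMap.proj (R := ℝ) (φ := fun _ : Fin n => Polynomial ℝ) ⟨n - 1, by omega⟩)
  convert Polynomial.linearIndependent_X_pow_fin ℝ (K' + 1) using 2 with j
  have h : n - t ≤ n - 1 := by omega
  simp only [Function.comp_apply, LinearMap.proj_apply, uTuple, if_pos h]

theorem disjoint_span_wTuple_uTuple {n t : ℕ} (K' : ℕ) (htn : 2 * t < n) :
    Disjoint (Submodule.span ℝ (Set.range (wTuple n K' t)))
      (Submodule.span ℝ (Set.range (uTuple n K' t))) := by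
  rw [Submodule.disjoint_def]
  intro f hw hu
  funext i
  by_cases hi : (i : ℕ) < t
  · refine Submodule.span_apply_eq_zero ?_ hu
    rintro _ ⟨j, rfl⟩
    exact if_neg (by omega)
  · refine Submodule.span_apply_eq_zero ?_ hw
    rintro _ ⟨j, rfl⟩
    exact if_neg hi

/-- with `Ĥ` the span of the adaptive filters alone, `ℍ ⊓ Ĥ = ⊥`,
`ℍ ⊔ Ĥ = ℍ'`, and `dim Ĥ = 2K' + 2`; i.e. `ℍ' = ℍ ⊕ Ĥ` internally. -/
theorem adaptive_filters_direct_sum (n K K' t : ℕ) (hK' : K' ≤ K) (ht : 1 ≤ t)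
    (htn : 2 * t < n) :
    (Submodule.span ℝ (Set.range (vTuple n K))
        ⊓ Submodule.span ℝ (Set.range (wTuple n K' t) ∪ Set.range (uTuple n K' t)) = ⊥)
      ∧ (Submodule.span ℝ (Set.range (vTuple n K))
          ⊔ Submodule.span ℝ (Set.range (wTuple n K' t) ∪ Set.range (uTuple n K' t))
        = Submodule.span ℝ
            (Set.range (vTuple n K) ∪ Set.range (wTuple n K' t)
              ∪ Set.range (uTuple n K' t)))
      ∧ Module.finrank ℝ ↥(Submodule.span ℝ
            (Set.range (wTuple n K' t) ∪ Set.range (uTuple n K' t))) = 2 * K' + 2 := by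
  refine ⟨?_, ?_, ?_⟩
  · rw [eq_bot_iff]
    rintro f ⟨hv, hwu⟩
    have hmid : f ⟨t, by omega⟩ = 0 := by
      refine Submodule.span_apply_eq_zero ?_ hwu
      rintro _ (⟨j, rfl⟩ | ⟨j, rfl⟩)
      · exact if_neg (lt_irrefl t)
      · refine if_neg ?_
        dsimp only
        omega
    rw [Submodule.mem_bot]
    funext i
    refine (Submodule.span_apply_eq_apply ?_ hv).trans hmid
    rintro _ ⟨k, rfl⟩
    rfl
  · rw [← Submodule.span_union, Set.union_assoc]
  · have hli := (linearIndependent_wTuple K' ht (by omega)).sum_type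
      (linearIndependent_uTuple K' ht (by omega)) (disjoint_span_wTuple_uTuple K' htn)
    rw [← Set.Sum.elim_range, finrank_span_eq_card hli]
    simp only [Fintype.card_sum, Fintype.card_fin]
    omega
end
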